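/- arXiv:2507.00771 — 6 statements merged into one kernel-verified Lean document; each statement's English description precedes it below -/
import Mathlib

section
/- Let R be a commutative Noetherian ring, let M be a finitely generated R-module, and let i be a natural number. Then the set of prime ideals p of R such that Tor_i^{R_p}(M_p, κ(p)) ≠ 0 is a closed subset of the prime spectrum Spec R with its Zariski topology (here κ(p) denotes the residue field of the local ring R_p, and by flat base change this set equals {p : Tor_i^R(M, κ(p)) ≠ 0}). -/
open CategoryTheory Limits

universe u
open MonoidalCategory

section TorAux
variable {A : Type u} [CommRing A]

noncomputable abbrev torCx (X : ModuleCat.{u} A) {N : ModuleCat.{u} A} (P : ProjectiveResolution N) :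
    ChainComplex (ModuleCat.{u} A) ℕ :=
  (((tensoringLeft (ModuleCat.{u} A)).obj X).mapHomologicalComplex _).obj P.complex

noncomputable abbrev torCxMap {X Y : ModuleCat.{u} A} (f : X ⟶ Y) {N : ModuleCat.{u} A}
    (P : ProjectiveResolution N) : torCx X P ⟶ torCx Y P :=
  (NatTrans.mapHomologicalComplex ((tensoringLeft (ModuleCat.{u} A)).map f) _).app P.complex

lemma isZero_tor_iff (X N : ModuleCat.{u} A) (P : ProjectiveResolution N) (n : ℕ) :
    IsZero (((Tor (ModuleCat.{u} A) n).obj X).obj N) ↔ IsZero ((torCx X P).homology n) :=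
  (P.isoLeftDerivedObj ((tensoringLeft (ModuleCat.{u} A)).obj X) n).isZero_iff

noncomputable abbrev torSC (S : ShortComplex (ModuleCat.{u} A)) {N : ModuleCat.{u} A}
    (P : ProjectiveResolution N) : ShortComplex (ChainComplex (ModuleCat.{u} A) ℕ) :=
  ShortComplex.mk (torCxMap S.f P) (torCxMap S.g P) (by
    ext n : 1
    have h : S.f ▷ P.complex.X n ≫ S.g ▷ P.complex.X n = 0 := by
      rw [← comp_whiskerRight, S.zero, MonoidalPreadditive.zero_whiskerRight]
    exact h)

lemma torSC_shortExact (S : ShortComplex (ModuleCat.{u} A)) (hS : S.ShortExact)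
    {N : ModuleCat.{u} A} (P : ProjectiveResolution N) : (torSC S P).ShortExact := by
  apply HomologicalComplex.shortExact_of_degreewise_shortExact
  intro i
  have : Module.Projective A (P.complex.X i) := 
    (IsProjective.iff_projective _).mpr (P.projective i)
  have : Module.Flat A (P.complex.X i) := inferInstance
  exact hS.map_of_exact (tensorRight (P.complex.X i))

lemma isZero_torCx_of_flat (X : ModuleCat.{u} A) [Module.Flat A X] {N : ModuleCat.{u} A}
    (P : ProjectiveResolution N) (n : ℕ) : IsZero ((torCx X P).homology (n + 1)) := by
  have h : (P.complex.sc (n+1)).Exact := P.complex_exactAt_succ n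
  have h2 := Module.Flat.lTensor_shortComplex_exact X _ h
  exact (HomologicalComplex.exactAt_iff_isZero_homology _ _).mp h2

lemma tor_shift (S : ShortComplex (ModuleCat.{u} A)) (hS : S.ShortExact) [Module.Flat A S.X₂]
    (N : ModuleCat.{u} A) (n : ℕ) :
    IsZero (((Tor (ModuleCat.{u} A) (n+2)).obj S.X₃).obj N) ↔
    IsZero (((Tor (ModuleCat.{u} A) (n+1)).obj S.X₁).obj N) := by
  let P := projectiveResolution N
  rw [isZero_tor_iff _ _ P, isZero_tor_iff _ _ P]
  exact ((torSC_shortExact S hS P).δIso (n+2) (n+1) (by simp)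
    (isZero_torCx_of_flat _ P _) (isZero_torCx_of_flat _ P _)).isZero_iff

lemma mono_of_tor_one (S : ShortComplex (ModuleCat.{u} A)) (hS : S.ShortExact)
    (N : ModuleCat.{u} A) (h : IsZero (((Tor (ModuleCat.{u} A) 1).obj S.X₃).obj N)) :
    Mono (S.f ▷ N) := by
  let P := projectiveResolution N
  rw [isZero_tor_iff _ _ P] at h
  have hm : Mono (HomologicalComplex.homologyMap (torCxMap S.f P) 0) :=
    ((torSC_shortExact S hS P).homology_exact₁ 1 0 (by simp)).mono_g (h.eq_of_src _ _)
  have : IsIso (P.fromLeftDerivedZero' ((tensoringLeft (ModuleCat.{u} A)).obj S.X₁)) := by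
    have : PreservesFiniteColimits ((tensoringLeft (ModuleCat.{u} A)).obj S.X₁) :=
      inferInstanceAs (PreservesFiniteColimits (tensorLeft S.X₁))
    infer_instance
  have : IsIso (P.fromLeftDerivedZero' ((tensoringLeft (ModuleCat.{u} A)).obj S.X₂)) := by
    have : PreservesFiniteColimits ((tensoringLeft (ModuleCat.{u} A)).obj S.X₂) :=
      inferInstanceAs (PreservesFiniteColimits (tensorLeft S.X₂))
    infer_instance
  have sq : HomologicalComplex.homologyMap (torCxMap S.f P) 0 ≫ 
      (ChainComplex.isoHomologyι₀ _).hom ≫ P.fromLeftDerivedZero' _ = 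
      ((ChainComplex.isoHomologyι₀ _).hom ≫ P.fromLeftDerivedZero' _) ≫ (S.f ▷ N) := by
    have : HomologicalComplex.opcyclesMap (torCxMap S.f P) 0 ≫ P.fromLeftDerivedZero' _ =
        P.fromLeftDerivedZero' _ ≫ (S.f ▷ N) := by
      rw [← cancel_epi (HomologicalComplex.pOpcycles _ _)]
      rw [HomologicalComplex.p_opcyclesMap_assoc]
      rw [ProjectiveResolution.pOpcycles_comp_fromLeftDerivedZero',
        ProjectiveResolution.pOpcycles_comp_fromLeftDerivedZero'_assoc]
      exact (((tensoringLeft (ModuleCat.{u} A)).map S.f).naturality (P.π.f 0)).symm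
    simp only [ChainComplex.isoHomologyι₀, Category.assoc]
    simp [this]
  have e : S.f ▷ N = inv ((ChainComplex.isoHomologyι₀ _).hom ≫ P.fromLeftDerivedZero' ((tensoringLeft (ModuleCat.{u} A)).obj S.X₁)) ≫ HomologicalComplex.homologyMap (torCxMap S.f P) 0 ≫ 
      (ChainComplex.isoHomologyι₀ _).hom ≫ P.fromLeftDerivedZero' _ := by
    rw [IsIso.eq_inv_comp]; exact sq.symm
  rw [e]
  infer_instance

lemma shortExact_of_linear {X Y Z : Type u} [AddCommGroup X] [AddCommGroup Y] [AddCommGroup Z]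
    [Module A X] [Module A Y] [Module A Z] (f : X →ₗ[A] Y) (g : Y →ₗ[A] Z)
    (hf : Function.Injective f) (hg : Function.Surjective g) (h : Function.Exact f g) :
    (ShortComplex.mk (ModuleCat.ofHom f) (ModuleCat.ofHom g)
      (by ext x; exact h.apply_apply_eq_zero x)).ShortExact where
  exact := (ShortComplex.ShortExact.moduleCat_exact_iff_function_exact _).mpr h
  mono_f := (ModuleCat.mono_iff_injective _).mpr hf
  epi_g := (ModuleCat.epi_iff_surjective _).mpr hg

lemma exists_ses (R : Type u) [CommRing R] (M : Type u) [AddCommGroup M] [Module R M]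
    [Module.Finite R M] : ∃ (k : ℕ) (g : (Fin k → R) →ₗ[R] M), Function.Surjective g :=
  Module.Finite.exists_fin' R M

lemma tor_one_iff [IsLocalRing A] [IsNoetherianRing A] (M : Type u) [AddCommGroup M] [Module A M]
    [Module.Finite A M] :
    IsZero (((Tor (ModuleCat.{u} A) 1).obj (ModuleCat.of A M)).obj
      (ModuleCat.of A (IsLocalRing.ResidueField A))) ↔ Module.Free A M := by
  constructor
  · intro h
    obtain ⟨k, g, hg⟩ := exists_ses A M
    have hex : Function.Exact (LinearMap.ker g).subtype g := LinearMap.exact_subtype_ker_map g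
    have := mono_of_tor_one _ (shortExact_of_linear _ g (Submodule.injective_subtype _) hg hex) _ h
    rw [ModuleCat.mono_iff_injective] at this
    have h2 : Function.Injective
      ((LinearMap.ker g).subtype.rTensor (IsLocalRing.ResidueField A)) := this
    apply Module.free_of_lTensor_residueField_injective _ g hg hex
    rwa [LinearMap.lTensor_inj_iff_rTensor_inj]
  · intro h
    rw [isZero_tor_iff _ _ (projectiveResolution _)]
    have : Module.Flat A (ModuleCat.of A M) := inferInstanceAs (Module.Flat A M)
    exact isZero_torCx_of_flat _ _ 0

lemma tor_zero_iff [IsLocalRing A] (M : Type u) [AddCommGroup M] [Module A M]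
    [Module.Finite A M] :
    IsZero (((Tor (ModuleCat.{u} A) 0).obj (ModuleCat.of A M)).obj
      (ModuleCat.of A (IsLocalRing.ResidueField A))) ↔ Subsingleton M := by
  have : PreservesFiniteColimits ((tensoringLeft (ModuleCat.{u} A)).obj (ModuleCat.of A M)) :=
      inferInstanceAs (PreservesFiniteColimits (tensorLeft (ModuleCat.of A M)))
  have e := ((tensoringLeft (ModuleCat.{u} A)).obj (ModuleCat.of A M)).leftDerivedZeroIsoSelf.app
    (ModuleCat.of A (IsLocalRing.ResidueField A))
  refine e.isZero_iff.trans ?_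
  rw [ModuleCat.isZero_iff_subsingleton, ← IsLocalRing.subsingleton_tensorProduct (R := A) (M := M)]
  exact (TensorProduct.comm A M (IsLocalRing.ResidueField A)).toEquiv.subsingleton_congr

end TorAux

/-- Let `R` be a commutative Noetherian ring, `M` a finitely generated
`R`-module, and `i : ℕ`. Then the set of primes `p` such that
`Tor_i^{R_p}(M_p, κ(p)) ≠ 0` is closed in `Spec R`. -/
theorem isClosed_tor_ne_zero_locus (R : Type u) [CommRing R] [IsNoetherianRing R]
    (M : Type u) [AddCommGroup M] [Module R M] [Module.Finite R M] (i : ℕ) :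
    IsClosed {p : PrimeSpectrum R |
      ¬ IsZero (((Tor (ModuleCat.{u} (Localization.AtPrime p.asIdeal)) i).obj
          (ModuleCat.of (Localization.AtPrime p.asIdeal)
            (LocalizedModule p.asIdeal.primeCompl M))).obj
        (ModuleCat.of (Localization.AtPrime p.asIdeal)
          (IsLocalRing.ResidueField (Localization.AtPrime p.asIdeal))))} := by
  rcases i with _ | i
  · simp_rw [tor_zero_iff, not_subsingleton_iff_nontrivial]
    exact Module.isClosed_support (R := R) (M := M)
  · induction i generalizing M with
    | zero =>
      have (p : PrimeSpectrum R) : IsNoetherianRing (Localization.AtPrime p.asIdeal) :=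
        IsLocalization.isNoetherianRing p.asIdeal.primeCompl _ inferInstance
      simp_rw [zero_add, tor_one_iff]
      have : Module.FinitePresentation R M := Module.finitePresentation_of_finite R M
      have : IsOpen (Module.freeLocus R M) := Module.isOpen_freeLocus
      exact this.isClosed_compl
    | succ i ih =>
      obtain ⟨k, g, hg⟩ := exists_ses R M
      have hex : Function.Exact (LinearMap.ker g).subtype g := LinearMap.exact_subtype_ker_map g
      have := ih (LinearMap.ker g)
      convert this using 4 with p
      have hf : Module.Flat (Localization.AtPrime p.asIdeal)
        (LocalizedModule p.asIdeal.primeCompl (Fin k → R)) := inferInstance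
      exact tor_shift _ (shortExact_of_linear
        (LocalizedModule.map p.asIdeal.primeCompl (LinearMap.ker g).subtype)
        (LocalizedModule.map p.asIdeal.primeCompl g)
        (LocalizedModule.map_injective _ _ (Submodule.injective_subtype _))
        (LocalizedModule.map_surjective _ _ hg)
        (LocalizedModule.map_exact _ _ _ hex)) _ i
end

section
/- Let X be a Noetherian topological space, let f : X → X be a continuous closed map, and let Z ⊆ X be any closed subset. Then there exists a closed subset W ⊆ Z such that f(W) = W and Λ(W) = Λ(Z). -/
/-- Let `X` be a Noetherian topological space, `f : X → X` a continuous
closed map, and `Z ⊆ X` any closed subset. Then there is a closed subset `W ⊆ Z` with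
`f(W) = W` and `Λ(W) = Λ(Z)`, where
`Λ(S) = {x | f^[e] x ∈ S for all sufficiently large e}`. -/
theorem exists_pDynamicClosure {X : Type*} [TopologicalSpace X]
    [TopologicalSpace.NoetherianSpace X]
    (f : X → X) (hf : Continuous f) (hf' : IsClosedMap f)
    (Z : Set X) (hZ : IsClosed Z) :
    ∃ W : Set X, W ⊆ Z ∧ IsClosed W ∧ f '' W = W ∧
      {x : X | ∃ N : ℕ, ∀ e : ℕ, N ≤ e → f^[e] x ∈ W} =
        {x : X | ∃ N : ℕ, ∀ e : ℕ, N ≤ e → f^[e] x ∈ Z} := by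
  have wf : WellFoundedLT (TopologicalSpace.Closeds X) :=
    by
    have h := (TopologicalSpace.noetherianSpace_TFAE X).out 0 1
    exact h.mp ‹_›
  let L : Set X → Set X := fun S => {x : X | ∃ N : ℕ, ∀ e : ℕ, N ≤ e → f^[e] x ∈ S}
  obtain ⟨W, ⟨hWZ, hWL⟩, hmin⟩ := wf.wf.has_min
    {C : TopologicalSpace.Closeds X | (C : Set X) ⊆ Z ∧ L C = L Z}
    ⟨⟨Z, hZ⟩, subset_rfl, rfl⟩
  have key : ∀ D : Set X, IsClosed D →
      (∀ x, (∃ N : ℕ, ∀ e : ℕ, N ≤ e → f^[e] x ∈ (W : Set X)) →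
        ∃ N : ℕ, ∀ e : ℕ, N ≤ e → f^[e] x ∈ D) → (W : Set X) ⊆ D := by
    intro D hD h
    by_contra hn
    refine hmin ⟨(W : Set X) ∩ D, W.isClosed.inter hD⟩
      ⟨fun x hx => hWZ hx.1, ?_⟩ ?_
    · rw [← hWL]
      ext x
      constructor
      · rintro ⟨N, hN⟩
        exact ⟨N, fun e he => (hN e he).1⟩
      · rintro ⟨N, hN⟩
        obtain ⟨M, hM⟩ := h x ⟨N, hN⟩
        exact ⟨max N M, fun e he => ⟨hN e (le_trans (le_max_left _ _) he),
          hM e (le_trans (le_max_right _ _) he)⟩⟩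
    · refine lt_of_le_not_ge (fun x hx => hx.1) ?_
      intro hle
      exact hn fun x hx => (hle hx).2
  refine ⟨W, hWZ, W.isClosed, Set.Subset.antisymm ?_ ?_, hWL⟩
  · rw [Set.image_subset_iff]
    refine key _ (W.isClosed.preimage hf) ?_
    rintro x ⟨N, hN⟩
    refine ⟨N, fun e he => ?_⟩
    have := hN (e + 1) (by omega)
    rwa [Function.iterate_succ_apply'] at this
  · refine key _ (hf' _ W.isClosed) ?_
    rintro x ⟨N, hN⟩
    refine ⟨N + 1, fun e he => ?_⟩
    obtain ⟨k, rfl⟩ : ∃ k, e = k + 1 := ⟨e - 1, by omega⟩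
    rw [Function.iterate_succ_apply']
    exact ⟨_, hN k (by omega), rfl⟩
end

section
/- Let D be a pretriangulated category and Φ : D ⥤ D an additive functor. Let (M₁ →ᵃ M₂ →ᵇ M₃ →ᶜ M₁[1]) be a distinguished triangle and let θᵢ : Φ(Mᵢ) → Mᵢ (i = 1, 2, 3) be morphisms such that a ∘ θ₁ = θ₂ ∘ Φ(a) and b ∘ θ₂ = θ₃ ∘ Φ(b). If the pairs (M₁, θ₁) and (M₃, θ₃) are nilpotent, then so is (M₂, θ₂). -/
open CategoryTheory Limits Pretriangulated

section

variable {C : Type*} [Category C]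

/-- The object `Φ^e(M)`, the `e`-fold application of the endofunctor `Φ` to `M`. -/
def iterObj (Φ : C ⥤ C) (M : C) : ℕ → C
  | 0 => M
  | e + 1 => Φ.obj (iterObj Φ M e)

/-- Given `θ : Φ(M) ⟶ M`, the iterate `θ^{(e)} : Φ^e(M) ⟶ M`,
defined by `θ^{(0)} = 𝟙 M` and `θ^{(e+1)} = θ ∘ Φ(θ^{(e)})` (so `θ^{(1)} = θ`). -/
def iterMap (Φ : C ⥤ C) {M : C} (θ : Φ.obj M ⟶ M) : ∀ e : ℕ, iterObj Φ M e ⟶ M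
  | 0 => 𝟙 M
  | e + 1 => Φ.map (iterMap Φ θ e) ≫ θ

/-- A pair `(M, θ : Φ(M) ⟶ M)` is nilpotent if some iterate `θ^{(e)}`, `e ≥ 1`, is zero. -/
def IsNilpotentPair [HasZeroMorphisms C] (Φ : C ⥤ C) {M : C} (θ : Φ.obj M ⟶ M) : Prop :=
  ∃ e : ℕ, 1 ≤ e ∧ iterMap Φ θ e = 0

end

/-- Let `D` be a pretriangulated category, `Φ : D ⥤ D` an additive
functor, `(M₁ ⟶ M₂ ⟶ M₃ ⟶ M₁[1])` a distinguished triangle, and `θᵢ : Φ(Mᵢ) ⟶ Mᵢ`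
morphisms commuting with the maps of the triangle. If `(M₁, θ₁)` and `(M₃, θ₃)` are
nilpotent, so is `(M₂, θ₂)`. -/
theorem isNilpotentPair_of_distTriang {D : Type*} [Category D] [HasZeroObject D]
    [Preadditive D] [HasShift D ℤ] [∀ n : ℤ, (shiftFunctor D n).Additive]
    [Pretriangulated D]
    (Φ : D ⥤ D) [Φ.Additive]
    (T : Triangle D) (hT : T ∈ distTriang D)
    (θ₁ : Φ.obj T.obj₁ ⟶ T.obj₁) (θ₂ : Φ.obj T.obj₂ ⟶ T.obj₂)
    (θ₃ : Φ.obj T.obj₃ ⟶ T.obj₃)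
    (h₁ : θ₁ ≫ T.mor₁ = Φ.map T.mor₁ ≫ θ₂)
    (h₂ : θ₂ ≫ T.mor₂ = Φ.map T.mor₂ ≫ θ₃)
    (n₁ : IsNilpotentPair Φ θ₁) (n₃ : IsNilpotentPair Φ θ₃) :
    IsNilpotentPair Φ θ₂ := by
  obtain ⟨n, hn, e₁⟩ := n₁
  obtain ⟨m, hm, e₃⟩ := n₃
  have key₃ : ∀ k : ℕ, ∃ w : iterObj Φ T.obj₂ k ⟶ iterObj Φ T.obj₃ k,
      iterMap Φ θ₂ k ≫ T.mor₂ = w ≫ iterMap Φ θ₃ k := by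
    intro k
    induction k with
    | zero => exact ⟨T.mor₂, by simp only [iterMap]; exact (Category.id_comp _).trans (Category.comp_id _).symm⟩
    | succ k ih =>
      obtain ⟨w, hw⟩ := ih
      refine ⟨Φ.map w, ?_⟩
      change (Φ.map (iterMap Φ θ₂ k) ≫ θ₂) ≫ T.mor₂ = Φ.map w ≫ Φ.map (iterMap Φ θ₃ k) ≫ θ₃
      rw [Category.assoc, h₂, ← Category.assoc, ← Φ.map_comp, hw, Φ.map_comp, Category.assoc]
  have hz : iterMap Φ θ₂ m ≫ T.mor₂ = 0 := by
    obtain ⟨w, hw⟩ := key₃ m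
    rw [hw, e₃, comp_zero]
  obtain ⟨u, hu⟩ := Triangle.coyoneda_exact₂ T hT _ hz
  have key₁ : ∀ k : ℕ, ∃ w : iterObj Φ T.obj₂ (m + k) ⟶ iterObj Φ T.obj₁ k,
      iterMap Φ θ₂ (m + k) = w ≫ iterMap Φ θ₁ k ≫ T.mor₁ := by
    intro k
    induction k with
    | zero =>
      refine ⟨u, hu.trans ?_⟩
      exact congrArg (u ≫ ·) (Category.id_comp T.mor₁).symm
    | succ k ih =>
      obtain ⟨w, hw⟩ := ih
      refine ⟨Φ.map w, ?_⟩
      change Φ.map (iterMap Φ θ₂ (m + k)) ≫ θ₂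
        = Φ.map w ≫ (Φ.map (iterMap Φ θ₁ k) ≫ θ₁) ≫ T.mor₁
      rw [hw, Category.assoc, h₁, Φ.map_comp, Φ.map_comp, Category.assoc, Category.assoc]
  obtain ⟨w, hw⟩ := key₁ n
  exact ⟨m + n, by omega, by rw [hw, e₁, zero_comp, comp_zero]⟩
end

section
/- Let A be an abelian category and Φ : A ⥤ A an exact functor. Let 0 → M₁ →ᵃ M₂ →ᵇ M₃ → 0 be a short exact sequence in A and let θᵢ : Φ(Mᵢ) → Mᵢ (i = 1, 2, 3) be morphisms such that a ∘ θ₁ = θ₂ ∘ Φ(a) and b ∘ θ₂ = θ₃ ∘ Φ(b). Then the pair (M₂, θ₂) is nilpotent if and only if both (M₁, θ₁) and (M₃, θ₃) are nilpotent. -/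
open CategoryTheory Limits

section

variable {C : Type*} [Category C]

/-- `Φ^e(g)`. -/
def iterHom (Φ : C ⥤ C) {M N : C} (g : M ⟶ N) : ∀ e : ℕ, iterObj Φ M e ⟶ iterObj Φ N e
  | 0 => g
  | e + 1 => Φ.map (iterHom Φ g e)

theorem iterMap_comm (Φ : C ⥤ C) {M N : C} (g : M ⟶ N) (θ : Φ.obj M ⟶ M) (θ' : Φ.obj N ⟶ N)
    (h : θ ≫ g = Φ.map g ≫ θ') (e : ℕ) :
    iterMap Φ θ e ≫ g = iterHom Φ g e ≫ iterMap Φ θ' e := by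
  induction e with
  | zero => exact (Category.id_comp g).trans (Category.comp_id g).symm
  | succ e ih =>
    change (Φ.map (iterMap Φ θ e) ≫ θ) ≫ g = Φ.map (iterHom Φ g e) ≫ Φ.map (iterMap Φ θ' e) ≫ θ'
    rw [Category.assoc, h, ← Category.assoc, ← Φ.map_comp, ih, Φ.map_comp, Category.assoc]

theorem iterHom_epi (Φ : C ⥤ C) [Φ.PreservesEpimorphisms] {M N : C} (g : M ⟶ N) [Epi g] (e : ℕ) :
    Epi (iterHom Φ g e) := by
  induction e with
  | zero => assumption
  | succ e ih => exact Φ.map_epi (iterHom Φ g e)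

theorem iterMap_factor (Φ : C ⥤ C) {M N : C} (f : M ⟶ N) (θ : Φ.obj M ⟶ M) (θ' : Φ.obj N ⟶ N)
    (h : θ ≫ f = Φ.map f ≫ θ') (n : ℕ) (k : iterObj Φ N n ⟶ M) (hk : k ≫ f = iterMap Φ θ' n)
    (m : ℕ) : ∃ k' : iterObj Φ N (n + m) ⟶ iterObj Φ M m,
      iterMap Φ θ' (n + m) = k' ≫ iterMap Φ θ m ≫ f := by
  induction m with
  | zero => exact ⟨k, hk.symm.trans (congrArg (k ≫ ·) (Category.id_comp f).symm)⟩
  | succ m ih =>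
    obtain ⟨k', hk'⟩ := ih
    refine ⟨Φ.map k', ?_⟩
    change Φ.map (iterMap Φ θ' (n + m)) ≫ θ' = Φ.map k' ≫ (Φ.map (iterMap Φ θ m) ≫ θ) ≫ f
    rw [hk', Φ.map_comp, Φ.map_comp]
    simp only [Category.assoc, h]

end

/-- Let `A` be an abelian category and `Φ : A ⥤ A` an exact functor.
Given a short exact sequence `0 ⟶ M₁ ⟶ M₂ ⟶ M₃ ⟶ 0` and morphisms `θᵢ : Φ(Mᵢ) ⟶ Mᵢ`
commuting with the maps of the sequence, the pair `(M₂, θ₂)` is nilpotent if and only if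
both `(M₁, θ₁)` and `(M₃, θ₃)` are nilpotent. -/
theorem isNilpotentPair_iff_of_shortExact {A : Type*} [Category A] [Abelian A]
    (Φ : A ⥤ A) [PreservesFiniteLimits Φ] [PreservesFiniteColimits Φ]
    (S : ShortComplex A) (hS : S.ShortExact)
    (θ₁ : Φ.obj S.X₁ ⟶ S.X₁) (θ₂ : Φ.obj S.X₂ ⟶ S.X₂) (θ₃ : Φ.obj S.X₃ ⟶ S.X₃)
    (h₁ : θ₁ ≫ S.f = Φ.map S.f ≫ θ₂)
    (h₂ : θ₂ ≫ S.g = Φ.map S.g ≫ θ₃) :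
    IsNilpotentPair Φ θ₂ ↔ (IsNilpotentPair Φ θ₁ ∧ IsNilpotentPair Φ θ₃) := by
  have := hS.mono_f
  have := hS.epi_g
  constructor
  · rintro ⟨e, he, h⟩
    refine ⟨⟨e, he, ?_⟩, ⟨e, he, ?_⟩⟩
    · rw [← cancel_mono S.f, iterMap_comm Φ S.f θ₁ θ₂ h₁, h, comp_zero, zero_comp]
    · have := iterHom_epi Φ S.g e
      rw [← cancel_epi (iterHom Φ S.g e), ← iterMap_comm Φ S.g θ₂ θ₃ h₂, h, comp_zero, zero_comp]
  · rintro ⟨⟨m, hm, h⟩, ⟨n, hn, h'⟩⟩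
    have h0 : iterMap Φ θ₂ n ≫ S.g = 0 := by
      rw [iterMap_comm Φ S.g θ₂ θ₃ h₂, h', comp_zero]
    obtain ⟨k', hk'⟩ := iterMap_factor Φ S.f θ₁ θ₂ h₁ n (hS.exact.lift _ h0)
      (hS.exact.lift_f _ h0) m
    exact ⟨n + m, by omega, by rw [hk', h, zero_comp, comp_zero]⟩
end

section
/- Let A be an abelian category, let D(A) be its derived category with homology functors Hⁿ : D(A) ⥤ A, let Φ₀ : A ⥤ A be an exact functor, and let Φ : D(A) ⥤ D(A) be a triangulated endofunctor equipped with natural isomorphisms Hⁿ ∘ Φ ≅ Φ₀ ∘ Hⁿ for all n ∈ ℤ (for instance, the functor on the derived category induced by Φ₀). Let M be an object of D(A) with Hⁿ(M) = 0 for all but finitely many n, and let θ : Φ(M) → M be a morphism. If for every n ∈ ℤ the pair (Hⁿ(M), Φ₀(Hⁿ(M)) → Hⁿ(M)) — where the map is Hⁿ(θ) transported along the given isomorphism — is nilpotent in A, then the pair (M, θ) is nilpotent in D(A), i.e. the iterate θ^{(e)} : Φ^{e}(M) → M is the zero morphism for some e ≥ 1. -/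
open CategoryTheory Limits

universe w v u


section

variable {C : Type*} [Category C]

def iterFunctorMap (Φ : C ⥤ C) {X Y : C} (f : X ⟶ Y) :
    ∀ e : ℕ, iterObj Φ X e ⟶ iterObj Φ Y e
  | 0 => f
  | e + 1 => Φ.map (iterFunctorMap Φ f e)

lemma iterMap_naturality (Φ : C ⥤ C) {X Y : C} (f : X ⟶ Y)
    (a : Φ.obj X ⟶ X) (b : Φ.obj Y ⟶ Y) (h : a ≫ f = Φ.map f ≫ b) (e : ℕ) :
    iterMap Φ a e ≫ f = iterFunctorMap Φ f e ≫ iterMap Φ b e := by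
  induction e with
  | zero =>
    change 𝟙 X ≫ f = f ≫ 𝟙 Y
    simp
  | succ e ih =>
    change (Φ.map (iterMap Φ a e) ≫ a) ≫ f =
      Φ.map (iterFunctorMap Φ f e) ≫ Φ.map (iterMap Φ b e) ≫ b
    rw [Category.assoc, h, ← Category.assoc, ← Functor.map_comp, ih, Functor.map_comp,
      Category.assoc]

lemma epi_iterFunctorMap (Φ : C ⥤ C) [Φ.PreservesEpimorphisms] {X Y : C} (f : X ⟶ Y) [Epi f]
    (e : ℕ) : Epi (iterFunctorMap Φ f e) := by
  induction e with
  | zero => change Epi f; infer_instance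
  | succ e ih => change Epi (Φ.map (iterFunctorMap Φ f e)); infer_instance

lemma nilp_of_mono [HasZeroMorphisms C] (Φ : C ⥤ C) {X Y : C} (f : X ⟶ Y) [Mono f]
    (a : Φ.obj X ⟶ X) (b : Φ.obj Y ⟶ Y) (h : a ≫ f = Φ.map f ≫ b)
    (hb : IsNilpotentPair Φ b) : IsNilpotentPair Φ a := by
  obtain ⟨e, he, h0⟩ := hb
  refine ⟨e, he, ?_⟩
  rw [← cancel_mono f, iterMap_naturality Φ f a b h, h0, comp_zero, zero_comp]

lemma nilp_of_epi [HasZeroMorphisms C] (Φ : C ⥤ C) [Φ.PreservesEpimorphisms]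
    {X Y : C} (f : X ⟶ Y) [Epi f]
    (a : Φ.obj X ⟶ X) (b : Φ.obj Y ⟶ Y) (h : a ≫ f = Φ.map f ≫ b)
    (ha : IsNilpotentPair Φ a) : IsNilpotentPair Φ b := by
  obtain ⟨e, he, h0⟩ := ha
  refine ⟨e, he, ?_⟩
  have := epi_iterFunctorMap Φ f e
  rw [← cancel_epi (iterFunctorMap Φ f e), ← iterMap_naturality Φ f a b h, h0, comp_zero,
    zero_comp]

lemma nilp_of_isZero [HasZeroMorphisms C] (Φ : C ⥤ C) {X : C} (hX : IsZero X)
    (a : Φ.obj X ⟶ X) : IsNilpotentPair Φ a :=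
  ⟨1, le_rfl, hX.eq_of_tgt _ _⟩

lemma iterMap_factor_s9 (Φ : C ⥤ C) {X Y : C} (f : X ⟶ Y)
    (a : Φ.obj X ⟶ X) (b : Φ.obj Y ⟶ Y) (h : a ≫ f = Φ.map f ≫ b) (m : ℕ)
    (s : iterObj Φ Y m ⟶ X) (hs : iterMap Φ b m = s ≫ f) (e : ℕ) :
    ∃ u : iterObj Φ Y (m + e) ⟶ iterObj Φ X e, iterMap Φ b (m + e) = u ≫ iterMap Φ a e ≫ f := by
  induction e with
  | zero =>
    refine ⟨s, ?_⟩
    change iterMap Φ b m = s ≫ 𝟙 X ≫ f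
    rw [hs, Category.id_comp]
  | succ e ih =>
    obtain ⟨u, hu⟩ := ih
    refine ⟨Φ.map u, ?_⟩
    change Φ.map (iterMap Φ b (m + e)) ≫ b = Φ.map u ≫ (Φ.map (iterMap Φ a e) ≫ a) ≫ f
    rw [hu, Functor.map_comp, Functor.map_comp]
    simp only [Category.assoc, h]

lemma iterMap_transport {D : Type*} [Category D] (Φ : C ⥤ C) (Φ₀ : D ⥤ D) (H : C ⥤ D)
    (e : Φ ⋙ H ≅ H ⋙ Φ₀) {M : C} (θ : Φ.obj M ⟶ M) (k : ℕ) :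
    ∃ i : H.obj (iterObj Φ M k) ≅ iterObj Φ₀ (H.obj M) k,
      H.map (iterMap Φ θ k) =
        i.hom ≫ iterMap Φ₀ ((e.inv.app M ≫ H.map θ : Φ₀.obj (H.obj M) ⟶ H.obj M)) k := by
  induction k with
  | zero =>
    refine ⟨Iso.refl _, ?_⟩
    change H.map (𝟙 M) = 𝟙 _ ≫ 𝟙 _
    simp
  | succ k ih =>
    obtain ⟨i, hi⟩ := ih
    refine ⟨e.app (iterObj Φ M k) ≪≫ Φ₀.mapIso i, ?_⟩
    change H.map (Φ.map (iterMap Φ θ k) ≫ θ) = (e.hom.app (iterObj Φ M k) ≫ Φ₀.map i.hom) ≫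
      Φ₀.map (iterMap Φ₀ ((e.inv.app M ≫ H.map θ : Φ₀.obj (H.obj M) ⟶ H.obj M)) k) ≫
        e.inv.app M ≫ H.map θ
    have h1 := e.hom.naturality (iterMap Φ θ k)
    dsimp at h1
    rw [Category.assoc, ← Functor.map_comp_assoc Φ₀, ← hi, ← reassoc_of% h1, H.map_comp]
    have := e.hom_inv_id_app M
    dsimp at this
    rw [reassoc_of% this]

lemma transport_comm {D : Type*} [Category D] (Φ : C ⥤ C) (Φ₀ : D ⥤ D) (H : C ⥤ D)
    (e : Φ ⋙ H ≅ H ⋙ Φ₀) {X Y : C} (f : X ⟶ Y)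
    (a : Φ.obj X ⟶ X) (b : Φ.obj Y ⟶ Y) (h : a ≫ f = Φ.map f ≫ b) :
    (e.inv.app X ≫ H.map a : Φ₀.obj (H.obj X) ⟶ H.obj X) ≫ H.map f =
      Φ₀.map (H.map f) ≫ (e.inv.app Y ≫ H.map b : Φ₀.obj (H.obj Y) ⟶ H.obj Y) := by
  have h1 := e.inv.naturality f
  dsimp at h1
  rw [Category.assoc, ← H.map_comp, h, H.map_comp, reassoc_of% h1]

end


section

open Pretriangulated

variable {A : Type u} [Category.{v} A] [Abelian A] [HasDerivedCategory.{w} A]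

lemma derived_eq_zero_of_homology (n : ℤ) (X Y : DerivedCategory A)
    [X.IsGE n] [X.IsLE n] [Y.IsGE n] [Y.IsLE n] (f : X ⟶ Y)
    (hf : (DerivedCategory.homologyFunctor A n).map f = 0) : f = 0 := by
  obtain ⟨X', ⟨i⟩⟩ := X.exists_iso_singleFunctor_obj_of_isGE_of_isLE n
  obtain ⟨Y', ⟨j⟩⟩ := Y.exists_iso_singleFunctor_obj_of_isGE_of_isLE n
  obtain ⟨g, hg⟩ := (DerivedCategory.singleFunctor A n).map_surjective (i.inv ≫ f ≫ j.hom)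
  have h1 := NatIso.naturality_1 (DerivedCategory.singleFunctorCompHomologyFunctorIso A n) g
  have h2 : g = 0 := by
    dsimp at h1
    rw [hg] at h1
    rw [← h1]
    simp [hf]
  rw [h2, Functor.map_zero] at hg
  rw [← cancel_epi i.inv, ← cancel_mono j.hom, Category.assoc, ← hg]
  simp

lemma derived_nilp_aux
    (Φ₀ : A ⥤ A) [PreservesFiniteLimits Φ₀] [PreservesFiniteColimits Φ₀]
    (Φ : DerivedCategory A ⥤ DerivedCategory A) [Φ.CommShift ℤ] [Φ.IsTriangulated]
    (e : ∀ n : ℤ, Φ ⋙ DerivedCategory.homologyFunctor A n ≅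
      DerivedCategory.homologyFunctor A n ⋙ Φ₀) (k : ℕ) :
    ∀ (a b : ℤ) (_ : b = a + k) (M : DerivedCategory A) (_ : M.IsGE a) (_ : M.IsLE b)
    (θ : Φ.obj M ⟶ M)
    (_ : ∀ n : ℤ, IsNilpotentPair Φ₀
      (((e n).inv.app M ≫ (DerivedCategory.homologyFunctor A n).map θ :
        Φ₀.obj ((DerivedCategory.homologyFunctor A n).obj M) ⟶
          (DerivedCategory.homologyFunctor A n).obj M))),
    IsNilpotentPair Φ θ := by
  have : Φ₀.PreservesZeroMorphisms := inferInstance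
  have hZ : ∀ (X : DerivedCategory A) (n : ℤ),
      IsZero ((DerivedCategory.homologyFunctor A n).obj X) →
      IsZero ((DerivedCategory.homologyFunctor A n).obj (Φ.obj X)) := fun X n h ↦
    (Φ₀.map_isZero h).of_iso ((e n).app X)
  have hGE : ∀ (X : DerivedCategory A) (n : ℤ), X.IsGE n → (Φ.obj X).IsGE n := by
    intro X n h
    rw [DerivedCategory.isGE_iff] at h ⊢
    exact fun i hi ↦ hZ _ _ (h i hi)
  have hLE : ∀ (X : DerivedCategory A) (n : ℤ), X.IsLE n → (Φ.obj X).IsLE n := by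
    intro X n h
    rw [DerivedCategory.isLE_iff] at h ⊢
    exact fun i hi ↦ hZ _ _ (h i hi)
  induction k with
  | zero =>
    intro a b hab M h1 h2 θ hnil
    obtain rfl : b = a := by simpa using hab
    obtain ⟨m, hm, h0⟩ := hnil b
    refine ⟨m, hm, ?_⟩
    have g1 : ∀ r, (iterObj Φ M r).IsGE b := by
      intro r
      induction r with
      | zero => exact h1
      | succ r ih => exact hGE _ _ ih
    have g2 : ∀ r, (iterObj Φ M r).IsLE b := by
      intro r
      induction r with
      | zero => exact h2
      | succ r ih => exact hLE _ _ ih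
    have := g1 m
    have := g2 m
    apply derived_eq_zero_of_homology b
    obtain ⟨i, hi⟩ := iterMap_transport Φ Φ₀ (DerivedCategory.homologyFunctor A b) (e b) θ m
    rw [hi, h0, comp_zero]
  | succ k ih =>
    intro a b hab M h1 h2 θ hnil
    obtain ⟨L, R, hL, hR, ι, π, δ, hT⟩ :=
      DerivedCategory.TStructure.t.exists_triangle M a (a + 1) rfl
    have hL : L.IsLE a := ⟨hL⟩
    have hR : R.IsGE (a + 1) := ⟨hR⟩
    have hΦL := hLE L a hL
    have hιπ : ι ≫ π = 0 := comp_distTriang_mor_zero₁₂ _ hT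
    have hz : (Φ.map ι ≫ θ) ≫ π = 0 :=
      DerivedCategory.TStructure.t.zero _ a (a + 1) (by lia)
    obtain ⟨θL, hθL⟩ : ∃ θL : Φ.obj L ⟶ L, θL ≫ ι = Φ.map ι ≫ θ := by
      obtain ⟨g, hg⟩ := Triangle.coyoneda_exact₂ _ hT (Φ.map ι ≫ θ) hz
      exact ⟨g, hg.symm⟩
    obtain ⟨θR, hθR⟩ : ∃ θR : Φ.obj R ⟶ R, θ ≫ π = Φ.map π ≫ θR := by
      obtain ⟨g, hg⟩ := Triangle.yoneda_exact₂ _ (Φ.map_distinguished _ hT) (θ ≫ π)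
        ((Category.assoc _ _ _).symm.trans hz)
      exact ⟨g, hg⟩
    -- homology
    have zL : ∀ n, a < n → IsZero ((DerivedCategory.homologyFunctor A n).obj L) :=
      (DerivedCategory.isLE_iff _ _).1 hL
    have zR : ∀ n, n < a + 1 → IsZero ((DerivedCategory.homologyFunctor A n).obj R) :=
      (DerivedCategory.isGE_iff _ _).1 hR
    have mL : ∀ n, n ≤ a → Mono ((DerivedCategory.homologyFunctor A n).map ι) := by
      intro n hn
      exact (DerivedCategory.HomologySequence.mono_homologyMap_mor₁_iff _ hT (n - 1) n
        (by lia)).2 ((zR (n - 1) (by lia)).eq_of_src _ _)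
    have eR : ∀ n, a ≤ n → Epi ((DerivedCategory.homologyFunctor A n).map π) := by
      intro n hn
      exact (DerivedCategory.HomologySequence.epi_homologyMap_mor₂_iff _ hT n (n + 1)
        (by lia)).2 ((zL (n + 1) (by lia)).eq_of_tgt _ _)
    have mR : ∀ n, a < n → Mono ((DerivedCategory.homologyFunctor A n).map π) := by
      intro n hn
      exact (DerivedCategory.HomologySequence.mono_homologyMap_mor₂_iff _ hT n).2
        ((zL n hn).eq_of_src _ _)
    have zM1 : ∀ n, n < a → IsZero ((DerivedCategory.homologyFunctor A n).obj M) :=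
      (DerivedCategory.isGE_iff _ _).1 h1
    have zM2 : ∀ n, b < n → IsZero ((DerivedCategory.homologyFunctor A n).obj M) :=
      (DerivedCategory.isLE_iff _ _).1 h2
    have hL' : L.IsGE a := by
      rw [DerivedCategory.isGE_iff]
      intro n hn
      have := mL n hn.le
      exact IsZero.of_mono ((DerivedCategory.homologyFunctor A n).map ι) (zM1 n hn)
    have hR' : R.IsLE b := by
      rw [DerivedCategory.isLE_iff]
      intro n hn
      have := eR n (by push_cast at hab; lia)
      exact IsZero.of_epi ((DerivedCategory.homologyFunctor A n).map π) (zM2 n hn)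
    have nL : IsNilpotentPair Φ θL := by
      have ih0 := ih a (a + k) rfl L hL'
        (DerivedCategory.TStructure.t.isLE_of_le L a (a + k) (by lia)) θL
      apply ih0
      intro n
      by_cases hn : n ≤ a
      · have := mL n hn
        exact nilp_of_mono Φ₀ ((DerivedCategory.homologyFunctor A n).map ι) _ _
          (transport_comm Φ Φ₀ _ (e n) ι θL θ hθL) (hnil n)
      · exact nilp_of_isZero Φ₀ (zL n (by lia)) _
    have nR : IsNilpotentPair Φ θR := by
      apply ih (a + 1) b (by push_cast at hab; lia) R hR hR' θR
      intro n
      by_cases hn : a < n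
      · have := eR n hn.le
        exact nilp_of_epi Φ₀ ((DerivedCategory.homologyFunctor A n).map π) _ _
          (transport_comm Φ Φ₀ _ (e n) π θ θR hθR) (hnil n)
      · exact nilp_of_isZero Φ₀ (zR n (by lia)) _
    obtain ⟨p, hp, hp0⟩ := nL
    obtain ⟨q, hq, hq0⟩ := nR
    have hs : iterMap Φ θ q ≫ π = 0 := by
      rw [iterMap_naturality Φ π θ θR hθR, hq0, comp_zero]
    obtain ⟨s, hs⟩ := Triangle.coyoneda_exact₂ _ hT (iterMap Φ θ q) hs
    obtain ⟨u, hu⟩ := iterMap_factor_s9 Φ ι θL θ hθL q s hs p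
    refine ⟨q + p, by lia, ?_⟩
    rw [hu, hp0, zero_comp, comp_zero]

end

/-- Let `A` be an abelian category with derived category `D(A)` and
homology functors `Hⁿ`, let `Φ₀ : A ⥤ A` be an exact functor, and let
`Φ : D(A) ⥤ D(A)` be a triangulated endofunctor equipped with isomorphisms
`Hⁿ ∘ Φ ≅ Φ₀ ∘ Hⁿ`. If `M` has bounded homology and `θ : Φ(M) ⟶ M` induces a
nilpotent pair on each `Hⁿ(M)` (after transporting along the given isomorphisms),
then `(M, θ)` is nilpotent in `D(A)`. -/
theorem isNilpotentPair_of_homology_nilpotent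
    {A : Type u} [Category.{v} A] [Abelian A] [HasDerivedCategory.{w} A]
    (Φ₀ : A ⥤ A) [PreservesFiniteLimits Φ₀] [PreservesFiniteColimits Φ₀]
    (Φ : DerivedCategory A ⥤ DerivedCategory A) [Φ.CommShift ℤ] [Φ.IsTriangulated]
    (e : ∀ n : ℤ, Φ ⋙ DerivedCategory.homologyFunctor A n ≅
      DerivedCategory.homologyFunctor A n ⋙ Φ₀)
    (M : DerivedCategory A)
    (hbdd : {n : ℤ | ¬ IsZero ((DerivedCategory.homologyFunctor A n).obj M)}.Finite)
    (θ : Φ.obj M ⟶ M)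
    (hnil : ∀ n : ℤ, IsNilpotentPair Φ₀
      (((e n).inv.app M ≫ (DerivedCategory.homologyFunctor A n).map θ :
        Φ₀.obj ((DerivedCategory.homologyFunctor A n).obj M) ⟶
          (DerivedCategory.homologyFunctor A n).obj M))) :
    IsNilpotentPair Φ θ := by
  obtain ⟨lo, hlo⟩ := hbdd.bddBelow
  obtain ⟨hi, hhi⟩ := hbdd.bddAbove
  refine derived_nilp_aux Φ₀ Φ e (hi - lo).toNat lo (lo + (hi - lo).toNat) rfl M ?_ ?_ θ hnil
  · rw [DerivedCategory.isGE_iff]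
    intro i hi'
    by_contra h
    have := hlo h
    lia
  · rw [DerivedCategory.isLE_iff]
    intro i hi'
    by_contra h
    have := hhi h
    lia
end

section
/- Let (R, m, k) be a commutative Noetherian local ring and let φ : R → R be a flat ring homomorphism such that the ideal of R generated by φ(m) equals m. Let N be a finitely generated R-module and θ : N → φ^{*}N an R-linear map, giving the direct system (φ^{e*}N)_{e ≥ 0} with transition maps φ^{e*}θ. Then for every natural number i: if the colimit over e of Tor_i^R(φ^{e*}N, k) (with transition maps induced by φ^{e*}θ) is zero, then the colimit over e of Tor_{i+1}^R(φ^{e*}N, k) is also zero. -/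
open CategoryTheory Limits

universe u

section

variable {R : Type u} [CommRing R]

/-- The `e`-fold pullback `φ^{e*}N = N ⊗_{R, φ^e} R` of a module `N` along a ring
endomorphism `φ : R → R`, realized by iterating the extension-of-scalars functor. -/
noncomputable def pullIter (φ : R →+* R) (N : ModuleCat.{u} R) : ℕ → ModuleCat.{u} R
  | 0 => N
  | e + 1 => (ModuleCat.extendScalars φ).obj (pullIter φ N e)

/-- The transition maps `φ^{e*}θ : φ^{e*}N ⟶ φ^{(e+1)*}N` of the direct system induced
by `θ : N ⟶ φ^{*}N`. -/
noncomputable def pullSys (φ : R →+* R) {N : ModuleCat.{u} R}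
    (θ : N ⟶ (ModuleCat.extendScalars φ).obj N) :
    ∀ e : ℕ, pullIter φ N e ⟶ pullIter φ N (e + 1)
  | 0 => θ
  | e + 1 => (ModuleCat.extendScalars φ).map (pullSys φ θ e)

end


section PartA

variable {R : Type u} [CommRing R]

/-- The range of `f` lies in `I` times the target. -/
def RangeIn {M N : ModuleCat.{u} R} (f : M ⟶ N) (I : Ideal R) : Prop :=
  ∀ x : M, f.hom x ∈ (I • ⊤ : Submodule R N)

lemma RangeIn.comp {M N P : ModuleCat.{u} R} {f : M ⟶ N} {g : N ⟶ P} {I J : Ideal R}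
    (hf : RangeIn f I) (hg : RangeIn g J) : RangeIn (f ≫ g) (I * J) := by
  intro x
  have h1 : (I • ⊤ : Submodule R N).map g.hom ≤ (I * J) • ⊤ := by
    rw [Submodule.map_smul'', Submodule.mul_smul]
    refine Submodule.smul_mono le_rfl ?_
    rintro _ ⟨y, -, rfl⟩
    exact hg y
  exact h1 ⟨_, hf x, rfl⟩

lemma RangeIn.comp_right {M N P : ModuleCat.{u} R} {f : M ⟶ N} (g : N ⟶ P) {I : Ideal R}
    (hf : RangeIn f I) : RangeIn (f ≫ g) I := by
  intro x
  have h1 : (I • ⊤ : Submodule R N).map g.hom ≤ I • ⊤ := by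
    rw [Submodule.map_smul'']
    exact Submodule.smul_mono le_rfl le_top
  exact h1 ⟨_, hf x, rfl⟩

lemma RangeIn.comp_left {M N P : ModuleCat.{u} R} (f : M ⟶ N) {g : N ⟶ P} {I : Ideal R}
    (hg : RangeIn g I) : RangeIn (f ≫ g) I := fun x => hg (f.hom x)

/-- `m ↦ 1 ⊗ m`. -/
noncomputable def unitT (φ : R →+* R) {M : ModuleCat.{u} R} (m : M) :
    (ModuleCat.extendScalars φ).obj M :=
  (ModuleCat.ExtendRestrictScalarsAdj.Unit.map φ (X := M)).hom m

lemma unitT_add (φ : R →+* R) {M : ModuleCat.{u} R} (m m' : M) :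
    unitT φ (m + m') = unitT φ m + unitT φ m' :=
  map_add (ModuleCat.ExtendRestrictScalarsAdj.Unit.map φ (X := M)).hom m m'

lemma unitT_smul (φ : R →+* R) {M : ModuleCat.{u} R} (r : R) (m : M) :
    unitT φ (r • m) = φ r • unitT φ m :=
  map_smul (ModuleCat.ExtendRestrictScalarsAdj.Unit.map φ (X := M)).hom r m

lemma map_unitT (φ : R →+* R) {M N : ModuleCat.{u} R} (g : M ⟶ N) (m : M) :
    ((ModuleCat.extendScalars φ).map g).hom (unitT φ m) = unitT φ (g.hom m) := rfl

lemma unitT_gen (φ : R →+* R) {M : ModuleCat.{u} R}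
    (P : Submodule R ((ModuleCat.extendScalars φ).obj M))
    (h : ∀ m : M, unitT φ m ∈ P) (x : (ModuleCat.extendScalars φ).obj M) : x ∈ P := by
  have : ModuleCat.ofHom P.mkQ =
      (0 : (ModuleCat.extendScalars φ).obj M ⟶ ModuleCat.of R _) := by
    apply ModuleCat.ExtendScalars.hom_ext
    intro m
    exact (Submodule.Quotient.mk_eq_zero P).2 (h m)
  have h2 : P.mkQ = 0 := congrArg ModuleCat.Hom.hom this
  rw [← Submodule.ker_mkQ P, h2]
  simp

lemma unitT_mem (φ : R →+* R) {M : ModuleCat.{u} R} (I : Ideal R) (m : M)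
    (hm : m ∈ (I • ⊤ : Submodule R M)) :
    unitT φ m ∈ (I.map φ • ⊤ : Submodule R ((ModuleCat.extendScalars φ).obj M)) := by
  induction hm using Submodule.smul_induction_on' with
  | smul r hr n hn =>
    rw [unitT_smul]
    exact Submodule.smul_mem_smul (Ideal.mem_map_of_mem φ hr) trivial
  | add x hx y hy h1 h2 =>
    rw [unitT_add]
    exact Submodule.add_mem _ h1 h2

lemma RangeIn.extend (φ : R →+* R) {M N : ModuleCat.{u} R} {f : M ⟶ N} {I : Ideal R}
    (hf : RangeIn f I) : RangeIn ((ModuleCat.extendScalars φ).map f) (I.map φ) := by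
  intro x
  exact unitT_gen φ ((I.map φ • ⊤ : Submodule R _).comap
    ((ModuleCat.extendScalars φ).map f).hom) (fun m => by
      rw [Submodule.mem_comap, map_unitT]
      exact unitT_mem φ I _ (hf m)) x

lemma extend_smul_zero (φ : R →+* R) {M : ModuleCat.{u} R} (I : Ideal R)
    (h : ∀ r ∈ I, ∀ m : M, r • m = 0) :
    (I.map φ • ⊤ : Submodule R ((ModuleCat.extendScalars φ).obj M)) = ⊥ := by
  rw [eq_bot_iff, Ideal.map, Submodule.span_smul_eq, Submodule.set_smul_le_iff]
  rintro _ _ ⟨r, hr, rfl⟩ -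
  rename_i n
  exact unitT_gen φ (LinearMap.ker (φ r • (LinearMap.id :
    ((ModuleCat.extendScalars φ).obj M) →ₗ[R] _))) (fun m => by
      simp only [LinearMap.mem_ker, LinearMap.smul_apply, LinearMap.id_apply]
      rw [← unitT_smul, h r hr]
      simpa using unitT_smul φ 0 (0 : M)) n

/-- Artin-Rees type property. -/
def AR {K F : ModuleCat.{u} R} (g : K ⟶ F) (I J : Ideal R) : Prop :=
  ∀ x : K, g.hom x ∈ (I • ⊤ : Submodule R F) → x ∈ (J • ⊤ : Submodule R K)

lemma AR.extend (φ : R →+* R) (hφ : φ.Flat) {K F : ModuleCat.{u} R} {g : K ⟶ F} {I J : Ideal R}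
    (hg : AR g I J) : AR ((ModuleCat.extendScalars φ).map g) (I.map φ) (J.map φ) := by
  have := ModuleCat.preservesFiniteLimits_extendScalars_of_flat hφ
  let E := ModuleCat.extendScalars.{u, u, u} φ
  let q : F ⟶ ModuleCat.of R (F ⧸ (I • ⊤ : Submodule R F)) := ModuleCat.ofHom (Submodule.mkQ _)
  let L := ModuleCat.of R (LinearMap.ker (g ≫ q).hom)
  let l : L ⟶ K := ModuleCat.ofHom (Submodule.subtype _)
  have w : l ≫ (g ≫ q) = 0 := by
    ext x
    exact x.2
  let S := ShortComplex.mk l (g ≫ q) w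
  have hS : S.Exact := by
    rw [ShortComplex.moduleCat_exact_iff]
    intro x hx
    exact ⟨⟨x, hx⟩, rfl⟩
  have hl : RangeIn l J := by
    intro x
    apply hg
    exact (Submodule.Quotient.mk_eq_zero _).1 x.2
  have hS' : (S.map E).Exact := hS.map E
  intro x hx
  rw [ShortComplex.moduleCat_exact_iff] at hS'
  have hz : (I.map φ • ⊤ : Submodule R (E.obj S.X₃)) = ⊥ := by
    apply extend_smul_zero
    intro r hr m
    obtain ⟨m, rfl⟩ := Submodule.mkQ_surjective _ m
    rw [← map_smul]
    exact (Submodule.Quotient.mk_eq_zero _).2 (Submodule.smul_mem_smul hr trivial)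
  obtain ⟨y, hy⟩ := hS' x (by
    have h1 : (E.map q).hom ((E.map g).hom x) ∈ (I.map φ • ⊤ : Submodule R (E.obj S.X₃)) := by
      have h2 : (I.map φ • ⊤ : Submodule R (E.obj F)).map (E.map q).hom ≤ I.map φ • ⊤ := by
        rw [Submodule.map_smul'']
        exact Submodule.smul_mono le_rfl le_top
      exact h2 ⟨_, hx, rfl⟩
    rw [hz] at h1
    change (E.map (g ≫ q)).hom x = 0
    rw [E.map_comp]
    exact h1)
  rw [← hy]
  exact hl.extend φ y

end PartA


section PartB

variable {R : Type u} [CommRing R]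

/-- Iterated pullback of a morphism. -/
noncomputable def pullMap (φ : R →+* R) {M N : ModuleCat.{u} R} (g : M ⟶ N) :
    ∀ e : ℕ, pullIter φ M e ⟶ pullIter φ N e
  | 0 => g
  | e + 1 => (ModuleCat.extendScalars φ).map (pullMap φ g e)

lemma pullMap_comm (φ : R →+* R) {M N : ModuleCat.{u} R} (g : M ⟶ N)
    (θM : M ⟶ (ModuleCat.extendScalars φ).obj M) (θN : N ⟶ (ModuleCat.extendScalars φ).obj N)
    (h : θM ≫ (ModuleCat.extendScalars φ).map g = g ≫ θN) (e : ℕ) :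
    pullSys φ θM e ≫ pullMap φ g (e + 1) = pullMap φ g e ≫ pullSys φ θN e := by
  induction e with
  | zero => exact h
  | succ e ih =>
    have := congrArg (ModuleCat.extendScalars φ).map ih
    rw [Functor.map_comp, Functor.map_comp] at this
    exact this

lemma pullMap_comp_zero (φ : R →+* R) {K F N : ModuleCat.{u} R} (f : K ⟶ F) (g : F ⟶ N)
    (w : f ≫ g = 0) (e : ℕ) : pullMap φ f e ≫ pullMap φ g e = 0 := by
  induction e with
  | zero => exact w
  | succ e ih =>
    have := congrArg (ModuleCat.extendScalars φ).map ih
    rw [Functor.map_comp, Functor.map_zero] at this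
    exact this

lemma pullMap_shortExact (φ : R →+* R) (hφ : φ.Flat) {K F N : ModuleCat.{u} R}
    (f : K ⟶ F) (g : F ⟶ N)
    (w : f ≫ g = 0) (h : (ShortComplex.mk f g w).ShortExact) (e : ℕ) :
    (ShortComplex.mk _ _ (pullMap_comp_zero φ f g w e)).ShortExact := by
  induction e with
  | zero => exact h
  | succ e ih =>
    have := ModuleCat.preservesFiniteLimits_extendScalars_of_flat hφ
    exact ih.map_of_exact (ModuleCat.extendScalars.{u, u, u} φ)

lemma pullIter_projective (φ : R →+* R) (F : ModuleCat.{u} R) [Projective F] (e : ℕ) :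
    Projective (pullIter φ F e) := by
  induction e with
  | zero => assumption
  | succ e ih =>
    exact (ModuleCat.extendRestrictScalarsAdj.{u, u, u} φ).map_projective _ ih

lemma pullMap_rangeIn (φ : R →+* R) {M N : ModuleCat.{u} R} (g : M ⟶ N) (m : Ideal R)
    (hm : m.map φ = m) (hg : RangeIn g m) (e : ℕ) : RangeIn (pullMap φ g e) m := by
  induction e with
  | zero => exact hg
  | succ e ih =>
    have := ih.extend φ
    rw [hm] at this
    exact this

lemma pullMap_AR (φ : R →+* R) (hφ : φ.Flat) {M N : ModuleCat.{u} R} (g : M ⟶ N) (m : Ideal R)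
    (hm : m.map φ = m) (n : ℕ) (hg : AR g (m ^ n) m) (e : ℕ) :
    AR (pullMap φ g e) (m ^ n) m := by
  induction e with
  | zero => exact hg
  | succ e ih =>
    have := ih.extend φ hφ
    rw [Ideal.map_pow, hm] at this
    exact this

/-- Transition maps. -/
noncomputable def pTrans (φ : R →+* R) {N : ModuleCat.{u} R}
    (θ : N ⟶ (ModuleCat.extendScalars φ).obj N) {i j : ℕ} (h : i ≤ j) :
    pullIter φ N i ⟶ pullIter φ N j :=
  (Functor.ofSequence (pullSys φ θ)).map (homOfLE h)

lemma pTrans_comp (φ : R →+* R) {N : ModuleCat.{u} R}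
    (θ : N ⟶ (ModuleCat.extendScalars φ).obj N) {i j k : ℕ} (h : i ≤ j) (h' : j ≤ k) :
    pTrans φ θ h ≫ pTrans φ θ h' = pTrans φ θ (h.trans h') :=
  ((Functor.ofSequence (pullSys φ θ)).map_comp (homOfLE h) (homOfLE h')).symm

lemma pTrans_refl (φ : R →+* R) {N : ModuleCat.{u} R}
    (θ : N ⟶ (ModuleCat.extendScalars φ).obj N) (i : ℕ) :
    pTrans φ θ (le_refl i) = 𝟙 _ :=
  (Functor.ofSequence (pullSys φ θ)).map_id i

lemma pTrans_one (φ : R →+* R) {N : ModuleCat.{u} R}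
    (θ : N ⟶ (ModuleCat.extendScalars φ).obj N) (i : ℕ) (h : i ≤ i + 1) :
    pTrans φ θ h = pullSys φ θ i :=
  Functor.ofSequence_map_homOfLE_succ (pullSys φ θ) i

lemma pTrans_succ (φ : R →+* R) {N : ModuleCat.{u} R}
    (θ : N ⟶ (ModuleCat.extendScalars φ).obj N) {i j : ℕ} (h : i ≤ j) :
    pTrans φ θ (Nat.succ_le_succ h) = (ModuleCat.extendScalars φ).map (pTrans φ θ h) := by
  induction j, h using Nat.le_induction with
  | base => rw [pTrans_refl, pTrans_refl]; exact ((ModuleCat.extendScalars φ).map_id _).symm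
  | succ j h ih =>
    rw [← pTrans_comp φ θ h (Nat.le_succ j), Functor.map_comp, ← ih,
      ← pTrans_comp φ θ (Nat.succ_le_succ h) (Nat.le_succ (j + 1)),
      pTrans_one, pTrans_one]
    rfl

lemma pTrans_comm (φ : R →+* R) {M N : ModuleCat.{u} R} (g : M ⟶ N)
    (θM : M ⟶ (ModuleCat.extendScalars φ).obj M) (θN : N ⟶ (ModuleCat.extendScalars φ).obj N)
    (h : θM ≫ (ModuleCat.extendScalars φ).map g = g ≫ θN) {i j : ℕ} (hij : i ≤ j) :
    pTrans φ θM hij ≫ pullMap φ g j = pullMap φ g i ≫ pTrans φ θN hij := by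
  induction j, hij using Nat.le_induction with
  | base => rw [pTrans_refl, pTrans_refl, Category.id_comp, Category.comp_id]
  | succ j hij ih =>
    rw [← pTrans_comp φ _ hij (Nat.le_succ j), ← pTrans_comp φ _ hij (Nat.le_succ j),
      ← reassoc_of% ih, pTrans_one, pTrans_one, Category.assoc, pullMap_comm φ g _ _ h]

lemma pTrans_rangeIn_shift (φ : R →+* R) {N : ModuleCat.{u} R}
    (θ : N ⟶ (ModuleCat.extendScalars φ).obj N) (m : Ideal R) (hm : m.map φ = m) (e : ℕ)
    (h : RangeIn (pTrans φ θ (Nat.zero_le e)) m) (a j : ℕ) (hj : j = e + a) (haj : a ≤ j) :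
    RangeIn (pTrans φ θ haj) m := by
  induction a generalizing j with
  | zero => subst hj; exact h
  | succ a ih =>
    subst hj
    have := (ih (e + a) rfl (by omega)).extend φ
    rw [hm, ← pTrans_succ] at this
    exact this

lemma pTrans_rangeIn_pow (φ : R →+* R) {N : ModuleCat.{u} R}
    (θ : N ⟶ (ModuleCat.extendScalars φ).obj N) (m : Ideal R) (hm : m.map φ = m) (e : ℕ)
    (h : RangeIn (pTrans φ θ (Nat.zero_le e)) m) (n : ℕ) :
    RangeIn (pTrans φ θ (Nat.zero_le (n * e))) (m ^ n) := by
  induction n with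
  | zero => intro x; simp
  | succ n ih =>
    have h1 := pTrans_rangeIn_shift φ θ m hm e h (n * e) ((n + 1) * e) (by ring)
      (Nat.mul_le_mul_right e (Nat.le_succ n))
    have := ih.comp h1
    rw [pTrans_comp, ← pow_succ] at this
    exact this

/-- The main step: vanishing mod `m` passes from `N` to the syzygy `K`. -/
lemma syzygy_rangeIn (φ : R →+* R) (hφ : φ.Flat) (m : Ideal R) (hm : m.map φ = m)
    {K F N : ModuleCat.{u} R} (f : K ⟶ F) (g : F ⟶ N)
    (w : f ≫ g = 0) (h : (ShortComplex.mk f g w).ShortExact)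
    (θK : K ⟶ (ModuleCat.extendScalars φ).obj K)
    (θF : F ⟶ (ModuleCat.extendScalars φ).obj F)
    (θN : N ⟶ (ModuleCat.extendScalars φ).obj N)
    (hK : θK ≫ (ModuleCat.extendScalars φ).map f = f ≫ θF)
    (hF : θF ≫ (ModuleCat.extendScalars φ).map g = g ≫ θN)
    (hf : RangeIn f m) (n : ℕ) (hn : AR f (m ^ n) m) (e : ℕ)
    (he : RangeIn (pTrans φ θN (Nat.zero_le e)) m) :
    RangeIn (pTrans φ θK (Nat.zero_le (n * e))) m := by
  have heF : RangeIn (pTrans φ θF (Nat.zero_le e)) m := by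
    intro x
    have hs := pullMap_shortExact φ hφ f g w h e
    have hsurj : Function.Surjective (pullMap φ g e).hom := hs.moduleCat_surjective_g
    have hex := hs.exact
    rw [ShortComplex.moduleCat_exact_iff] at hex
    have h1 : (pullMap φ g e).hom ((pTrans φ θF (Nat.zero_le e)).hom x) ∈
        (m • ⊤ : Submodule R (pullIter φ F e)).map (pullMap φ g e).hom := by
      rw [Submodule.map_smul'', Submodule.map_top, LinearMap.range_eq_top.2 hsurj]
      have := he ((pullMap φ g 0).hom x)
      have h2 := congrArg (fun t => t.hom x) (pTrans_comm φ g θF θN hF (Nat.zero_le e))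
      simp only [ModuleCat.hom_comp, LinearMap.comp_apply] at h2
      rw [h2]
      exact this
    obtain ⟨z, hz, hz'⟩ := h1
    obtain ⟨y, hy⟩ := hex ((pTrans φ θF (Nat.zero_le e)).hom x - z) (by
      change (pullMap φ g e).hom _ = 0
      rw [map_sub, hz', sub_self])
    have h3 := pullMap_rangeIn φ f m hm hf e y
    have h4 : (pullMap φ f e).hom y = (pTrans φ θF (Nat.zero_le e)).hom x - z := hy
    rw [h4] at h3
    simpa using Submodule.add_mem _ h3 hz
  have hpow := pTrans_rangeIn_pow φ θF m hm e heF n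
  intro x
  apply pullMap_AR φ hφ f m hm n hn
  have h2 := congrArg (fun t => t.hom x) (pTrans_comm φ f θK θF hK (Nat.zero_le (n * e)))
  simp only [ModuleCat.hom_comp, LinearMap.comp_apply] at h2
  rw [h2]
  exact hpow _

end PartB


section PartC

open MonoidalCategory

variable {R : Type u} [CommRing R] {k : ModuleCat.{u} R}

/-- `M ↦ M ⊗ Q`. -/
noncomputable def tensC (Q : ProjectiveResolution k) : ModuleCat.{u} R ⥤ ChainComplex (ModuleCat.{u} R) ℕ where
  obj M := (((tensoringLeft (ModuleCat.{u} R)).obj M).mapHomologicalComplex _).obj Q.complex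
  map f := (NatTrans.mapHomologicalComplex ((tensoringLeft (ModuleCat.{u} R)).map f) _).app Q.complex
  map_id M := by ext n : 1; simp
  map_comp f g := by ext n : 1; simp

instance (Q : ProjectiveResolution k) : (tensC Q).Additive where
  map_add {M N f g} := by
    ext n : 1
    change (f + g) ▷ Q.complex.X n = f ▷ Q.complex.X n + g ▷ Q.complex.X n
    simp

lemma leftDerived_app_comp {F G : ModuleCat.{u} R ⥤ ModuleCat.{u} R} [F.Additive] [G.Additive]
    (α : F ⟶ G) (Q : ProjectiveResolution k) (n : ℕ) :
    (NatTrans.leftDerived α n).app k ≫ (Q.isoLeftDerivedObj G n).hom =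
      (Q.isoLeftDerivedObj F n).hom ≫
        (HomologicalComplex.homologyFunctor _ (ComplexShape.down ℕ) n).map
        ((NatTrans.mapHomologicalComplex α _).app Q.complex) := by
  rw [ProjectiveResolution.leftDerived_app_eq α Q n, Category.assoc, Category.assoc, Iso.inv_hom_id,
    Category.comp_id]

lemma fromZero_naturality {F G : ModuleCat.{u} R ⥤ ModuleCat.{u} R} [F.Additive] [G.Additive]
    (α : F ⟶ G) (Q : ProjectiveResolution k) :
    HomologicalComplex.homologyMap ((NatTrans.mapHomologicalComplex α _).app Q.complex) 0 ≫
        ((G.mapHomologicalComplex _).obj Q.complex).homologyι 0 ≫ Q.fromLeftDerivedZero' G =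
      (((F.mapHomologicalComplex _).obj Q.complex).homologyι 0 ≫ Q.fromLeftDerivedZero' F) ≫
        α.app k := by
  rw [HomologicalComplex.homologyι_naturality_assoc, Category.assoc]
  congr 1
  rw [← cancel_epi (HomologicalComplex.pOpcycles _ _),
    HomologicalComplex.p_opcyclesMap_assoc,
    ProjectiveResolution.pOpcycles_comp_fromLeftDerivedZero',
    ProjectiveResolution.pOpcycles_comp_fromLeftDerivedZero'_assoc]
  exact (α.naturality (Q.π.f 0)).symm

/-- Tor computed from the resolution `Q`. -/
noncomputable def torIso (Q : ProjectiveResolution k) (n : ℕ) :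
    (Tor (ModuleCat.{u} R) n).flip.obj k ≅
      tensC Q ⋙ HomologicalComplex.homologyFunctor _ _ n :=
  NatIso.ofComponents (fun M => Q.isoLeftDerivedObj ((tensoringLeft (ModuleCat.{u} R)).obj M) n)
    (fun {_ _} f => leftDerived_app_comp ((tensoringLeft (ModuleCat.{u} R)).map f) Q n)

lemma tensC_shortExact (Q : ProjectiveResolution k) {K F N : ModuleCat.{u} R} {f : K ⟶ F} {g : F ⟶ N}
    {w : f ≫ g = 0} (h : (ShortComplex.mk f g w).ShortExact) :
    ((ShortComplex.mk f g w).map (tensC Q)).ShortExact := by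
  apply HomologicalComplex.shortExact_of_degreewise_shortExact
  intro i
  have hp : Projective (Q.complex.X i) := Q.projective i
  have : Module.Projective R (Q.complex.X i) := (IsProjective.iff_projective _).2 hp
  exact h.map_of_exact (tensorRight (Q.complex.X i))

lemma tensC_projective (Q : ProjectiveResolution k) (F : ModuleCat.{u} R) (hF : Projective F)
    (n : ℕ) : IsZero (((tensC Q).obj F).homology (n + 1)) := by
  have : Module.Projective R F := (IsProjective.iff_projective _).2 hF
  rw [← HomologicalComplex.exactAt_iff_isZero_homology]
  have h := Q.complex_exactAt_succ n
  rw [HomologicalComplex.exactAt_iff] at h ⊢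
  exact h.map (tensorLeft F)

/-- `Tor_0`. -/
noncomputable def homologyZeroIso (Q : ProjectiveResolution k) :
    tensC Q ⋙ HomologicalComplex.homologyFunctor _ _ 0 ≅ tensorRight k :=
  NatIso.ofComponents (fun M => (ChainComplex.isoHomologyι₀ ((tensC Q).obj M)) ≪≫
      @asIso _ _ _ _ (Q.fromLeftDerivedZero' ((tensoringLeft (ModuleCat.{u} R)).obj M))
        (inferInstanceAs (IsIso (Q.fromLeftDerivedZero' (tensorLeft M)))))
    (fun {_ _} f => fromZero_naturality ((tensoringLeft (ModuleCat.{u} R)).map f) Q)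

end PartC


section PartD

open MonoidalCategory

variable {R : Type u} [CommRing R]

lemma tensor_zero_iff [IsLocalRing R] (M : ModuleCat.{u} R) (x : M) :
    (x ⊗ₜ[R] (1 : IsLocalRing.ResidueField R) : TensorProduct R M (IsLocalRing.ResidueField R)) = 0
      ↔ x ∈ (IsLocalRing.maximalIdeal R • ⊤ : Submodule R M) := by
  rw [← Submodule.Quotient.mk_eq_zero, ← LinearEquiv.map_eq_zero_iff
    (TensorProduct.tensorQuotEquivQuotSMul M (IsLocalRing.maximalIdeal R)).symm,
    TensorProduct.tensorQuotEquivQuotSMul_symm_mk]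
  rfl

lemma RangeIn.whisker_zero [IsLocalRing R] {M N : ModuleCat.{u} R} {f : M ⟶ N}
    (hf : RangeIn f (IsLocalRing.maximalIdeal R)) :
    f ▷ (ModuleCat.of R (IsLocalRing.ResidueField R)) = 0 := by
  apply ModuleCat.MonoidalCategory.tensor_ext
  intro x a
  obtain ⟨r, rfl⟩ := Ideal.Quotient.mk_surjective a
  have h : (f.hom x ⊗ₜ[R] (1 : IsLocalRing.ResidueField R) :
      TensorProduct R N (IsLocalRing.ResidueField R)) = 0 :=
    (tensor_zero_iff N _).2 (hf x)
  change (f.hom x ⊗ₜ[R] (algebraMap R (IsLocalRing.ResidueField R) r) :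
      TensorProduct R N (IsLocalRing.ResidueField R)) = 0
  rw [Algebra.algebraMap_eq_smul_one, TensorProduct.tmul_smul, h, smul_zero]

lemma whiskerRight_tmul_eq_zero [IsLocalRing R] {M N : ModuleCat.{u} R} {f : M ⟶ N} (x : M)
    (h : (f ▷ (ModuleCat.of R (IsLocalRing.ResidueField R))).hom
      (x ⊗ₜ[R] (1 : IsLocalRing.ResidueField R) :
        TensorProduct R M (IsLocalRing.ResidueField R)) = 0) :
    f.hom x ∈ (IsLocalRing.maximalIdeal R • ⊤ : Submodule R N) :=
  (tensor_zero_iff N _).1 h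

lemma isZero_colimit_iff (G : ℕ ⥤ ModuleCat.{u} R) :
    IsZero (colimit G) ↔ ∀ (a : ℕ) (x : G.obj a), ∃ (b : ℕ) (h : a ≤ b),
      (G.map (homOfLE h)).hom x = 0 := by
  constructor
  · intro h a x
    have := preservesFilteredColimitsOfSize_shrink.{0, u, 0, u} (forget (ModuleCat.{u} R))
    obtain ⟨b, i, hb⟩ := Concrete.colimit_rep_eq_zero.{u, 0} R G a x (by
      rw [h.eq_of_tgt (colimit.ι G a) 0]; rfl)
    exact ⟨b, leOfHom i, hb⟩
  · intro h
    rw [IsZero.iff_id_eq_zero]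
    apply colimit.hom_ext
    intro a
    ext x
    obtain ⟨b, hab, hb⟩ := h a x
    rw [Category.comp_id, comp_zero, ← colimit.w G (homOfLE hab)]
    rw [ModuleCat.hom_comp, LinearMap.comp_apply, hb, map_zero]
    rfl

open IsLocalRing in
lemma exists_minimal_cover_aux [IsLocalRing R] (N : Type u) [AddCommGroup N] [Module R N]
    [Module.Finite R N] :
    ∃ (ι : Type u) (_ : Fintype ι) (p : (ι → R) →ₗ[R] N),
      Function.Surjective p ∧
      ∀ x, p x = 0 → x ∈ (maximalIdeal R • ⊤ : Submodule R (ι → R)) := by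
  classical
  let w := Module.Free.chooseBasis (ResidueField R) (TensorProduct R (ResidueField R) N)
  obtain ⟨v, hv⟩ := (TensorProduct.mk_surjective R N (ResidueField R)
    Ideal.Quotient.mk_surjective).comp_left w
  have hv' : ∀ i, (1 : (ResidueField R)) ⊗ₜ[R] v i = w i := fun i => congrFun hv i
  have hspan := IsLocalRing.span_eq_top_of_tmul_eq_basis v w hv'
  refine ⟨_, inferInstance, Fintype.linearCombination R v, ?_, ?_⟩
  · rw [← LinearMap.range_eq_top, Fintype.range_linearCombination, hspan]
  · intro x hx
    have hx' : ∑ i, x i • v i = 0 := hx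
    have h1 : ∑ i, (IsLocalRing.residue R (x i)) • w i = 0 := by
      have := congrArg (fun t => (1 : ResidueField R) ⊗ₜ[R] t) hx'
      simp only [TensorProduct.tmul_sum, TensorProduct.tmul_zero, TensorProduct.tmul_smul,
        hv'] at this
      rw [← this]
      refine Finset.sum_congr rfl fun i _ => ?_
      exact (algebraMap_smul (ResidueField R) (x i) (w i))
    have h2 := Fintype.linearIndependent_iff.1 w.linearIndependent _ h1
    rw [pi_eq_sum_univ x]
    refine Submodule.sum_mem _ fun i _ => Submodule.smul_mem_smul ?_ trivial
    exact (IsLocalRing.residue_eq_zero_iff _).1 (h2 i)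

lemma exists_minimal_cover [IsLocalRing R] (N : ModuleCat.{u} R) (hN : Module.Finite R N) :
    ∃ (F : ModuleCat.{u} R) (p : F ⟶ N), Projective F ∧ Module.Finite R F ∧
      Function.Surjective p.hom ∧
      ∀ x, p.hom x = 0 → x ∈ (IsLocalRing.maximalIdeal R • ⊤ : Submodule R F) := by
  obtain ⟨ι, _, p, h1, h2⟩ := exists_minimal_cover_aux (R := R) N
  refine ⟨ModuleCat.of R (ι → R), ModuleCat.ofHom p, ?_, ?_, h1, h2⟩
  · rw [← IsProjective.iff_projective]
    change Module.Projective R (ι → R)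
    infer_instance
  · change Module.Finite R (ι → R)
    infer_instance

lemma exists_AR [IsNoetherianRing R] {K F : ModuleCat.{u} R} (hF : Module.Finite R F) (f : K ⟶ F)
    (hf : Function.Injective f.hom) (m : Ideal R) : ∃ n, AR f (m ^ n) m := by
  obtain ⟨c, hc⟩ := Ideal.exists_pow_inf_eq_pow_smul m (LinearMap.range f.hom)
  refine ⟨c + 1, fun x hx => ?_⟩
  have h1 : f.hom x ∈ m ^ (c + 1 - c) • ((m ^ c • ⊤ : Submodule R F) ⊓ LinearMap.range f.hom) := by
    rw [← hc (c + 1) (Nat.le_succ c)]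
    exact ⟨hx, x, rfl⟩
  have h2 : f.hom x ∈ (m • ⊤ : Submodule R K).map f.hom := by
    rw [Submodule.map_smul'', Submodule.map_top]
    rw [Nat.add_sub_cancel_left, pow_one] at h1
    exact Submodule.smul_mono le_rfl inf_le_right h1
  obtain ⟨y, hy, hxy⟩ := h2
  rwa [← hf hxy]

end PartD


section PartE

open MonoidalCategory

variable {R : Type u} [CommRing R]

/-- A minimal free cover compatible with the structure maps. -/
structure Syz [IsLocalRing R] (φ : R →+* R) (N : ModuleCat.{u} R)
    (θN : N ⟶ (ModuleCat.extendScalars φ).obj N) where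
  K : ModuleCat.{u} R
  F : ModuleCat.{u} R
  f : K ⟶ F
  g : F ⟶ N
  w : f ≫ g = 0
  h : (ShortComplex.mk f g w).ShortExact
  hproj : Projective F
  hfin : Module.Finite R K
  hf : RangeIn f (IsLocalRing.maximalIdeal R)
  n : ℕ
  hn : AR f (IsLocalRing.maximalIdeal R ^ n) (IsLocalRing.maximalIdeal R)
  θK : K ⟶ (ModuleCat.extendScalars φ).obj K
  θF : F ⟶ (ModuleCat.extendScalars φ).obj F
  hK : θK ≫ (ModuleCat.extendScalars φ).map f = f ≫ θF
  hF : θF ≫ (ModuleCat.extendScalars φ).map g = g ≫ θN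

lemma exists_syz [IsNoetherianRing R] [IsLocalRing R] (φ : R →+* R) (hφ : φ.Flat)
    (N : ModuleCat.{u} R) (hN : Module.Finite R N)
    (θN : N ⟶ (ModuleCat.extendScalars φ).obj N) : Nonempty (Syz φ N θN) := by
  obtain ⟨F, g, hproj, hFfin, hsurj, hker⟩ := exists_minimal_cover N hN
  let K := ModuleCat.of R (LinearMap.ker g.hom)
  let f : K ⟶ F := ModuleCat.ofHom (Submodule.subtype _)
  have hinj : Function.Injective f.hom := Subtype.val_injective
  have w : f ≫ g = 0 := by
    ext x
    exact x.2
  have : Mono f := (ModuleCat.mono_iff_injective f).2 hinj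
  have : Epi g := (ModuleCat.epi_iff_surjective g).2 hsurj
  have hex : (ShortComplex.mk f g w).Exact := by
    rw [ShortComplex.moduleCat_exact_iff]
    intro x hx
    exact ⟨⟨x, hx⟩, rfl⟩
  have h : (ShortComplex.mk f g w).ShortExact := ShortComplex.ShortExact.mk hex
  obtain ⟨n, hn⟩ := exists_AR hFfin f hinj (IsLocalRing.maximalIdeal R)
  have := ModuleCat.preservesFiniteLimits_extendScalars_of_flat hφ
  have hE := h.map_of_exact (ModuleCat.extendScalars.{u, u, u} φ)
  have : Epi ((ModuleCat.extendScalars.{u, u, u} φ).map g) := hE.epi_g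
  have : Mono ((ModuleCat.extendScalars.{u, u, u} φ).map f) := hE.mono_f
  let θF : F ⟶ (ModuleCat.extendScalars φ).obj F :=
    Projective.factorThru (g ≫ θN) ((ModuleCat.extendScalars φ).map g)
  have hF : θF ≫ (ModuleCat.extendScalars φ).map g = g ≫ θN := Projective.factorThru_comp _ _
  have h0 : (f ≫ θF) ≫ (ModuleCat.extendScalars φ).map g = 0 := by
    rw [Category.assoc, hF, ← Category.assoc, w, zero_comp]
  have hmono := hE.mono_f
  obtain ⟨θK, hK⟩ : ∃ θK : K ⟶ (ModuleCat.extendScalars φ).obj K,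
      θK ≫ (ModuleCat.extendScalars φ).map f = f ≫ θF :=
    ⟨hE.exact.lift (f ≫ θF) h0, hE.exact.lift_f (f ≫ θF) h0⟩
  have hfin : Module.Finite R K := by
    change Module.Finite R (LinearMap.ker g.hom)
    infer_instance
  exact ⟨⟨K, F, f, g, w, h, hproj, hfin, fun x => hker _ x.2, n, hn, θK, θF, hK, hF⟩⟩

/-- The vanishing statement. -/
def Van [IsLocalRing R] (φ : R →+* R) (N : ModuleCat.{u} R)
    (θ : N ⟶ (ModuleCat.extendScalars φ).obj N) (i : ℕ) : Prop :=
  IsZero (colimit (Functor.ofSequence (pullSys φ θ) ⋙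
      (Tor (ModuleCat.{u} R) i).flip.obj (ModuleCat.of R (IsLocalRing.ResidueField R))))

lemma van_iff [IsLocalRing R] (φ : R →+* R) (N : ModuleCat.{u} R)
    (θ : N ⟶ (ModuleCat.extendScalars φ).obj N) (i : ℕ)
    (Q : ProjectiveResolution (ModuleCat.of R (IsLocalRing.ResidueField R))) :
    Van φ N θ i ↔ IsZero (colimit (Functor.ofSequence (pullSys φ θ) ⋙
      (tensC Q ⋙ HomologicalComplex.homologyFunctor _ _ i))) :=
  (HasColimit.isoOfNatIso (Functor.isoWhiskerLeft _ (torIso Q i))).isZero_iff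

lemma van_zero_iff [IsLocalRing R] (φ : R →+* R) (N : ModuleCat.{u} R)
    (θ : N ⟶ (ModuleCat.extendScalars φ).obj N)
    (Q : ProjectiveResolution (ModuleCat.of R (IsLocalRing.ResidueField R))) :
    Van φ N θ 0 ↔ IsZero (colimit (Functor.ofSequence (pullSys φ θ) ⋙
      tensorRight (ModuleCat.of R (IsLocalRing.ResidueField R)))) :=
  (van_iff φ N θ 0 Q).trans
    (HasColimit.isoOfNatIso (Functor.isoWhiskerLeft _ (homologyZeroIso Q))).isZero_iff

lemma rangeIn_of_van_zero [IsLocalRing R] (φ : R →+* R) (N : ModuleCat.{u} R)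
    (hN : Module.Finite R N)
    (θ : N ⟶ (ModuleCat.extendScalars φ).obj N)
    (Q : ProjectiveResolution (ModuleCat.of R (IsLocalRing.ResidueField R)))
    (h : Van φ N θ 0) :
    ∃ e, RangeIn (pTrans φ θ (Nat.zero_le e)) (IsLocalRing.maximalIdeal R) := by
  rw [van_zero_iff φ N θ Q, isZero_colimit_iff] at h
  have h1 : ∀ x : N, ∃ e, (pTrans φ θ (Nat.zero_le e)).hom x ∈
      (IsLocalRing.maximalIdeal R • ⊤ : Submodule R (pullIter φ N e)) := by
    intro x
    obtain ⟨b, hb, hx⟩ := h 0 (x ⊗ₜ[R] (1 : IsLocalRing.ResidueField R) :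
      TensorProduct R N (IsLocalRing.ResidueField R))
    exact ⟨b, whiskerRight_tmul_eq_zero (f := pTrans φ θ (Nat.zero_le b)) x hx⟩
  have hmono : ∀ (a b : ℕ) (_ : a ≤ b) (x : N), (pTrans φ θ (Nat.zero_le a)).hom x ∈
      (IsLocalRing.maximalIdeal R • ⊤ : Submodule R (pullIter φ N a)) →
      (pTrans φ θ (Nat.zero_le b)).hom x ∈
      (IsLocalRing.maximalIdeal R • ⊤ : Submodule R (pullIter φ N b)) := by
    intro a b hab x hx
    rw [← pTrans_comp φ θ (Nat.zero_le a) hab]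
    have h2 : (IsLocalRing.maximalIdeal R • ⊤ : Submodule R (pullIter φ N a)).map
        (pTrans φ θ hab).hom ≤ IsLocalRing.maximalIdeal R • ⊤ := by
      rw [Submodule.map_smul'']
      exact Submodule.smul_mono le_rfl le_top
    exact h2 ⟨_, hx, rfl⟩
  choose e he using h1
  obtain ⟨s, hs⟩ := hN.fg_top
  refine ⟨s.sup e, fun x => ?_⟩
  have h3 : (⊤ : Submodule R N) ≤ (IsLocalRing.maximalIdeal R • ⊤ :
      Submodule R (pullIter φ N (s.sup e))).comap (pTrans φ θ (Nat.zero_le (s.sup e))).hom := by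
    rw [← hs]
    exact Submodule.span_le.2 (fun y hy => hmono (e y) _ (Finset.le_sup hy) y (he y))
  exact h3 (Submodule.mem_top (x := x))

lemma van_zero_of_rangeIn [IsLocalRing R] (φ : R →+* R)
    (hm : (IsLocalRing.maximalIdeal R).map φ = IsLocalRing.maximalIdeal R) (N : ModuleCat.{u} R)
    (θ : N ⟶ (ModuleCat.extendScalars φ).obj N)
    (Q : ProjectiveResolution (ModuleCat.of R (IsLocalRing.ResidueField R)))
    (e : ℕ) (h : RangeIn (pTrans φ θ (Nat.zero_le e)) (IsLocalRing.maximalIdeal R)) :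
    Van φ N θ 0 := by
  rw [van_zero_iff φ N θ Q, isZero_colimit_iff]
  intro a x
  refine ⟨e + a, Nat.le_add_left a e, ?_⟩
  have h1 := (pTrans_rangeIn_shift φ θ _ hm e h a (e + a) rfl (Nat.le_add_left a e)).whisker_zero
  exact congrArg (fun t => t.hom x) h1

/-- Connecting maps. -/
noncomputable def connect {φ : R →+* R} [IsLocalRing R] (hφ : φ.Flat) {N : ModuleCat.{u} R}
    {θ : N ⟶ (ModuleCat.extendScalars φ).obj N} (S : Syz φ N θ)
    (Q : ProjectiveResolution (ModuleCat.of R (IsLocalRing.ResidueField R))) (i : ℕ) :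
    Functor.ofSequence (pullSys φ θ) ⋙
      (tensC Q ⋙ HomologicalComplex.homologyFunctor _ _ (i + 1)) ⟶
    Functor.ofSequence (pullSys φ S.θK) ⋙
      (tensC Q ⋙ HomologicalComplex.homologyFunctor _ _ i) :=
  NatTrans.ofSequence
    (fun e => (tensC_shortExact Q (pullMap_shortExact φ hφ S.f S.g S.w S.h e)).δ (i + 1) i rfl)
    (fun e => by
      let Φ : ShortComplex.mk _ _ (pullMap_comp_zero φ S.f S.g S.w e) ⟶
          ShortComplex.mk _ _ (pullMap_comp_zero φ S.f S.g S.w (e + 1)) :=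
        ShortComplex.homMk (pullSys φ S.θK e) (pullSys φ S.θF e) (pullSys φ θ e)
          (pullMap_comm φ S.f _ _ S.hK e) (pullMap_comm φ S.g _ _ S.hF e)
      have := HomologicalComplex.HomologySequence.δ_naturality
        ((tensC Q).mapShortComplex.map Φ)
        (tensC_shortExact Q (pullMap_shortExact φ hφ S.f S.g S.w S.h e))
        (tensC_shortExact Q (pullMap_shortExact φ hφ S.f S.g S.w S.h (e + 1))) (i + 1) i rfl
      have eN := Functor.ofSequence_map_homOfLE_succ (pullSys φ θ) e
      have eK := Functor.ofSequence_map_homOfLE_succ (pullSys φ S.θK) e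
      have aN : (Functor.ofSequence (pullSys φ θ) ⋙ (tensC Q ⋙
          HomologicalComplex.homologyFunctor _ _ (i + 1))).map (homOfLE (e.le_add_right 1)) =
          HomologicalComplex.homologyMap ((tensC Q).map (pullSys φ θ e)) (i + 1) :=
        congrArg (fun t => HomologicalComplex.homologyMap ((tensC Q).map t) (i + 1)) eN
      have aK : (Functor.ofSequence (pullSys φ S.θK) ⋙ (tensC Q ⋙
          HomologicalComplex.homologyFunctor _ _ i)).map (homOfLE (e.le_add_right 1)) =
          HomologicalComplex.homologyMap ((tensC Q).map (pullSys φ S.θK e)) i :=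
        congrArg (fun t => HomologicalComplex.homologyMap ((tensC Q).map t) i) eK
      exact (congrArg (fun t => t ≫ _) aN).trans (this.symm.trans (congrArg (fun t => _ ≫ t) aK.symm)))

lemma homologyMap_zero_of_whisker {k : ModuleCat.{u} R} (Q : ProjectiveResolution k)
    {M N : ModuleCat.{u} R} (f : M ⟶ N) (hf : f ▷ k = 0) :
    HomologicalComplex.homologyMap ((tensC Q).map f) 0 = 0 := by
  have h2 := (homologyZeroIso Q).hom.naturality f
  have h3 : (tensorRight k).map f = 0 := hf
  rw [h3, comp_zero] at h2
  have hi : IsIso ((homologyZeroIso Q).hom.app N) :=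
    ((homologyZeroIso Q).app N).isIso_hom
  have hmono : Mono ((homologyZeroIso Q).hom.app N) := @IsIso.mono_of_iso _ _ _ _ _ hi
  exact (@cancel_mono _ _ _ _ _ ((homologyZeroIso Q).hom.app N) hmono _ _).1
    (h2.trans zero_comp.symm)

lemma connect_isIso {φ : R →+* R} [IsLocalRing R] (hφ : φ.Flat)
    (hm : (IsLocalRing.maximalIdeal R).map φ = IsLocalRing.maximalIdeal R) {N : ModuleCat.{u} R}
    {θ : N ⟶ (ModuleCat.extendScalars φ).obj N} (S : Syz φ N θ)
    (Q : ProjectiveResolution (ModuleCat.of R (IsLocalRing.ResidueField R))) (i : ℕ) :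
    IsIso (connect hφ S Q i) := by
  have : ∀ e, IsIso ((connect hφ S Q i).app e) := by
    intro e
    have hS := tensC_shortExact Q (pullMap_shortExact φ hφ S.f S.g S.w S.h e)
    change IsIso (hS.δ (i + 1) i rfl)
    have := S.hproj
    have hp := pullIter_projective φ S.F e
    have hmono : Mono (hS.δ (i + 1) i rfl) := hS.mono_δ _ _ _ (tensC_projective Q _ hp i)
    have hepi : Epi (hS.δ (i + 1) i rfl) := by
      cases i with
      | succ i => exact hS.epi_δ _ _ _ (tensC_projective Q _ hp i)
      | zero =>
        refine (hS.homology_exact₁ 1 0 rfl).epi_f ?_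
        have h1 := (pullMap_rangeIn φ S.f _ hm S.hf e).whisker_zero
        exact homologyMap_zero_of_whisker Q _ h1
    have hb : Balanced (ModuleCat.{u} R) := balanced_of_strongMonoCategory
    exact @isIso_of_mono_of_epi _ _ hb _ _ _ hmono hepi
  exact @NatIso.isIso_of_isIso_app _ _ _ _ _ _ _ this

lemma van_succ_iff {φ : R →+* R} [IsLocalRing R] (hφ : φ.Flat)
    (hm : (IsLocalRing.maximalIdeal R).map φ = IsLocalRing.maximalIdeal R) {N : ModuleCat.{u} R}
    {θ : N ⟶ (ModuleCat.extendScalars φ).obj N} (S : Syz φ N θ) (i : ℕ)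
    (Q : ProjectiveResolution (ModuleCat.of R (IsLocalRing.ResidueField R))) :
    Van φ N θ (i + 1) ↔ Van φ S.K S.θK i := by
  rw [van_iff φ N θ (i + 1) Q, van_iff φ S.K S.θK i Q]
  have := connect_isIso hφ hm S Q i
  exact (HasColimit.isoOfNatIso (asIso (connect hφ S Q i))).isZero_iff

lemma van_main [IsNoetherianRing R] [IsLocalRing R]
    (φ : R →+* R) (hφ : φ.Flat)
    (hm : (IsLocalRing.maximalIdeal R).map φ = IsLocalRing.maximalIdeal R)
    (i : ℕ) : ∀ (N : ModuleCat.{u} R) (_ : Module.Finite R N)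
    (θ : N ⟶ (ModuleCat.extendScalars φ).obj N), Van φ N θ i → Van φ N θ (i + 1) := by
  have Q : ProjectiveResolution (ModuleCat.of R (IsLocalRing.ResidueField R)) :=
    projectiveResolution _
  induction i with
  | zero =>
    intro N hN θ h
    obtain ⟨S⟩ := exists_syz φ hφ N hN θ
    rw [van_succ_iff hφ hm S 0 Q]
    obtain ⟨e, he⟩ := rangeIn_of_van_zero φ N hN θ Q h
    exact van_zero_of_rangeIn φ hm S.K S.θK Q (S.n * e)
      (syzygy_rangeIn φ hφ _ hm S.f S.g S.w S.h S.θK S.θF θ S.hK S.hF S.hf S.n S.hn e he)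
  | succ i ih =>
    intro N hN θ h
    obtain ⟨S⟩ := exists_syz φ hφ N hN θ
    rw [van_succ_iff hφ hm S _ Q] at h ⊢
    exact ih S.K S.hfin S.θK h

end PartE


/-- Let `(R, m, k)` be a commutative Noetherian local ring and
`φ : R → R` a flat ring homomorphism with `φ(m)R = m`. Let `N` be a finitely generated
`R`-module and `θ : N ⟶ φ^{*}N`, giving the direct system `(φ^{e*}N)`. Then for every
`i : ℕ`: if `colim_e Tor_i^R(φ^{e*}N, k) = 0` then `colim_e Tor_{i+1}^R(φ^{e*}N, k) = 0`. -/
theorem colimit_tor_succ_isZero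
    {R : Type u} [CommRing R] [IsNoetherianRing R] [IsLocalRing R]
    (φ : R →+* R) (hφ : φ.Flat)
    (hm : (IsLocalRing.maximalIdeal R).map φ = IsLocalRing.maximalIdeal R)
    (N : ModuleCat.{u} R) (hN : Module.Finite R N)
    (θ : N ⟶ (ModuleCat.extendScalars φ).obj N) (i : ℕ)
    (h : IsZero (colimit (Functor.ofSequence (pullSys φ θ) ⋙
      (Tor (ModuleCat.{u} R) i).flip.obj (ModuleCat.of R (IsLocalRing.ResidueField R))))) :
    IsZero (colimit (Functor.ofSequence (pullSys φ θ) ⋙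
      (Tor (ModuleCat.{u} R) (i + 1)).flip.obj
        (ModuleCat.of R (IsLocalRing.ResidueField R)))) := by
  exact van_main φ hφ hm i N hN θ h
end
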